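/- Let γ : ℝ with γ ≠ 1, and let ρ, u, p : ℝ → ℝ → ℝ (functions of space x and time t). Assume that for all x, t: the functions τ ↦ ρ x τ, τ ↦ u x τ, and τ ↦ p x τ are differentiable at t; the functions ξ ↦ ρ ξ t, ξ ↦ u ξ t, and ξ ↦ p ξ t are differentiable at x; ρ x t ≠ 0; conservation of mass holds pointwise: deriv (fun τ ↦ ρ x τ) t = −deriv (fun ξ ↦ ρ ξ t * u ξ t) x; conservation of momentum holds pointwise: deriv (fun τ ↦ ρ x τ * u x τ) t = −deriv (fun ξ ↦ ρ ξ t * (u ξ t)^2 + p ξ t) x; and conservation of energy holds pointwise with the ideal-gas total energy ρe = p/(γ−1) + ρu²/2: deriv (fun τ ↦ p x τ/(γ−1) + ρ x τ * (u x τ)^2/2) t = −deriv (fun ξ ↦ (p ξ t/(γ−1) + ρ ξ t * (u ξ t)^2/2 + p ξ t) * u ξ t) x. Then for all x and t, deriv (fun τ ↦ p x τ) t = −γ * (p x t) * deriv (fun ξ ↦ u ξ t) x − (u x t) * deriv (fun ξ ↦ p ξ t) x. -/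

import Mathlib

theorem euler_pressure_evolution
    (γ : ℝ) (hγ : γ ≠ 1)
    (ρ u p : ℝ → ℝ → ℝ)
    (hρt : ∀ x t : ℝ, DifferentiableAt ℝ (fun τ => ρ x τ) t)
    (hut : ∀ x t : ℝ, DifferentiableAt ℝ (fun τ => u x τ) t)
    (hpt : ∀ x t : ℝ, DifferentiableAt ℝ (fun τ => p x τ) t)
    (hρx : ∀ x t : ℝ, DifferentiableAt ℝ (fun ξ => ρ ξ t) x)
    (hux : ∀ x t : ℝ, DifferentiableAt ℝ (fun ξ => u ξ t) x)
    (hpx : ∀ x t : ℝ, DifferentiableAt ℝ (fun ξ => p ξ t) x)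
    (hρ0 : ∀ x t : ℝ, ρ x t ≠ 0)
    (hmass : ∀ x t : ℝ,
      deriv (fun τ => ρ x τ) t = -deriv (fun ξ => ρ ξ t * u ξ t) x)
    (hmom : ∀ x t : ℝ,
      deriv (fun τ => ρ x τ * u x τ) t
        = -deriv (fun ξ => ρ ξ t * (u ξ t) ^ 2 + p ξ t) x)
    (henergy : ∀ x t : ℝ,
      deriv (fun τ => p x τ / (γ - 1) + ρ x τ * (u x τ) ^ 2 / 2) t
        = -deriv (fun ξ => (p ξ t / (γ - 1) + ρ ξ t * (u ξ t) ^ 2 / 2 + p ξ t) * u ξ t) x) :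
    ∀ x t : ℝ,
      deriv (fun τ => p x τ) t =
        -γ * (p x t) * deriv (fun ξ => u ξ t) x
          - (u x t) * deriv (fun ξ => p ξ t) x := by
  intro x t
  have a := (hρt x t).hasDerivAt
  have b := (hut x t).hasDerivAt
  have c := (hpt x t).hasDerivAt
  have a' := (hρx x t).hasDerivAt
  have b' := (hux x t).hasDerivAt
  have c' := (hpx x t).hasDerivAt
  have h1 := hmass x t
  have h2 := hmom x t
  have h3 := henergy x t
  have e1 := (a'.fun_mul b').deriv
  have e2 := (a.fun_mul b).deriv
  have e3 := ((a'.fun_mul (b'.fun_pow 2)).fun_add c').deriv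
  have e4 := ((c.div_const (γ - 1)).fun_add ((a.fun_mul (b.fun_pow 2)).div_const 2)).deriv
  have e5 := ((((c'.div_const (γ - 1)).fun_add
    ((a'.fun_mul (b'.fun_pow 2)).div_const 2)).fun_add c').fun_mul b').deriv
  rw [e1] at h1
  rw [e2, e3] at h2
  rw [e4, e5] at h3
  have hk : (γ - 1) * (γ - 1)⁻¹ = 1 := mul_inv_cancel₀ (sub_ne_zero.mpr hγ)
  simp only [div_eq_mul_inv _ (γ - 1)] at h3
  generalize (γ - 1)⁻¹ = k at h3 hk
  norm_num at h2 h3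
  linear_combination (γ - 1) * (h3 - u x t * h2 + (u x t) ^ 2 / 2 * h1)
    - (deriv (fun τ => p x τ) t + u x t * deriv (fun ξ => p ξ t) x
      + p x t * deriv (fun ξ => u ξ t) x) * hk
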